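/- A semisimple left Leibniz algebra A over a field of characteristic zero is complete: Z(A/Leib(A)) = 0 and every derivation δ of A satisfies im(δ − L_x) ⊆ Leib(A) for some x ∈ A. -/

import Mathlib

section Defs
variable {F A : Type*} [Field F] [AddCommGroup A] [Module F A]

def IsLeibniz (b : A →ₗ[F] A →ₗ[F] A) : Prop :=
  ∀ x y z : A, b x (b y z) = b (b x y) z + b y (b x z)

def IsDer (b : A →ₗ[F] A →ₗ[F] A) (δ : A →ₗ[F] A) : Prop :=
  ∀ x y : A, δ (b x y) = b (δ x) y + b x (δ y)

def IsIdeal (b : A →ₗ[F] A →ₗ[F] A) (I : Submodule F A) : Prop :=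
  ∀ x y : A, x ∈ I → b x y ∈ I ∧ b y x ∈ I

/-- An ideal invariant under all derivations: a characteristic ideal. -/
def IsCharIdeal (b : A →ₗ[F] A →ₗ[F] A) (I : Submodule F A) : Prop :=
  IsIdeal b I ∧ ∀ δ : A →ₗ[F] A, IsDer b δ → I.map δ ≤ I

/-- The span of all brackets `[x, y]` with `x ∈ S`, `y ∈ T`. -/
def bracketSpan (b : A →ₗ[F] A →ₗ[F] A) (S T : Submodule F A) : Submodule F A :=
  Submodule.span F {z | ∃ x ∈ S, ∃ y ∈ T, z = b x y}

/-- The derived series of a submodule. -/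
def derSeries (b : A →ₗ[F] A →ₗ[F] A) (I : Submodule F A) : ℕ → Submodule F A
  | 0 => I
  | n + 1 => bracketSpan b (derSeries b I n) (derSeries b I n)

def IsSolvableIdl (b : A →ₗ[F] A →ₗ[F] A) (I : Submodule F A) : Prop :=
  ∃ k : ℕ, derSeries b I k = ⊥

end Defs

def Leib {F A : Type*} [Field F] [AddCommGroup A] [Module F A]
    (b : A →ₗ[F] A →ₗ[F] A) : Submodule F A :=
  Submodule.span F {z | ∃ x : A, z = b x x}

section Helpers
variable {F A : Type*} [Field F] [AddCommGroup A] [Module F A]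

theorem leib_self_mem (b : A →ₗ[F] A →ₗ[F] A) (x : A) : b x x ∈ Leib b :=
  Submodule.subset_span ⟨x, rfl⟩

theorem leib_symm_mem (b : A →ₗ[F] A →ₗ[F] A) (x y : A) : b x y + b y x ∈ Leib b := by
  have h := Submodule.sub_mem _ (Submodule.sub_mem _ (leib_self_mem b (x + y)) (leib_self_mem b x))
    (leib_self_mem b y)
  have e : b (x + y) (x + y) - b x x - b y y = b x y + b y x := by
    simp only [map_add, LinearMap.add_apply]; abel
  rwa [e] at h

theorem leib_left_zero (b : A →ₗ[F] A →ₗ[F] A) (hb : IsLeibniz b) {x : A} (hx : x ∈ Leib b) :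
    b x = 0 := by
  have h : Leib b ≤ LinearMap.ker b := by
    refine Submodule.span_le.2 ?_
    rintro z ⟨x, rfl⟩
    refine LinearMap.mem_ker.2 (LinearMap.ext fun z => ?_)
    have := hb x x z
    simpa using this
  exact LinearMap.mem_ker.1 (h hx)

theorem leib_der (b : A →ₗ[F] A →ₗ[F] A) (δ : A →ₗ[F] A) (hδ : IsDer b δ) :
    Leib b ≤ (Leib b).comap δ := by
  refine Submodule.span_le.2 ?_
  rintro z ⟨x, rfl⟩
  change δ (b x x) ∈ Leib b
  rw [hδ]
  exact leib_symm_mem b _ _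

theorem lie_complete (L : Type*) [LieRing L] [LieAlgebra F L] [CharZero F] [FiniteDimensional F L]
    (h : ∀ I : LieIdeal F L, (∀ x ∈ I, ∀ y ∈ I, ⁅x, y⁆ = 0) → I = ⊥) :
    (∀ u : L, (∀ v : L, ⁅u, v⁆ = 0) → u = 0) ∧
    (∀ D : L →ₗ[F] L, (∀ x y : L, D ⁅x, y⁆ = ⁅D x, y⁆ + ⁅x, D y⁆) →
      ∃ x : L, ∀ y : L, D y = ⁅x, y⁆) := by
  have : LieAlgebra.HasTrivialRadical F L := by
    rw [LieAlgebra.hasTrivialRadical_iff_no_abelian_ideals]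
    intro I hI
    apply h
    intro x hx y hy
    have := hI.trivial ⟨x, hx⟩ ⟨y, hy⟩
    simpa using congrArg Subtype.val this
  refine ⟨fun u hu => ?_, fun D hD => ?_⟩
  · rw [← LieDerivation.IsKilling.ad_apply_eq_zero_iff (R := F)]
    ext v
    simpa using hu v
  · obtain ⟨x, hx⟩ := LieDerivation.IsKilling.exists_eq_ad (R := F) (L := L)
      { toLinearMap := D
        leibniz' := fun a b => by
          change D ⁅a, b⁆ = ⁅a, D b⁆ - ⁅b, D a⁆
          rw [hD, ← lie_skew b (D a)]; abel }
    refine ⟨x, fun y => ?_⟩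
    have := congrArg (fun d => d y) hx
    simpa using this.symm

end Helpers

/-- A semisimple left Leibniz algebra `A` (i.e. `rad(A) = Leib(A)`: every solvable ideal is
contained in `Leib(A)`) over a field of characteristic zero is complete:
`Z(A/Leib(A)) = 0` and every derivation `δ` of `A` satisfies `im(δ - L_x) ⊆ Leib(A)`
for some `x ∈ A`. -/
theorem semisimple_complete
    {F A : Type*} [Field F] [CharZero F] [AddCommGroup A] [Module F A]
    [FiniteDimensional F A]
    (b : A →ₗ[F] A →ₗ[F] A) (hb : IsLeibniz b)
    (hss : ∀ S : Submodule F A, IsIdeal b S → IsSolvableIdl b S → S ≤ Leib b)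
    (bq : (A ⧸ Leib b) →ₗ[F] (A ⧸ Leib b) →ₗ[F] (A ⧸ Leib b))
    (hbq : ∀ x y : A, bq ((Leib b).mkQ x) ((Leib b).mkQ y) = (Leib b).mkQ (b x y)) :
    (∀ u : A ⧸ Leib b, (∀ v : A ⧸ Leib b, bq u v = 0) → u = 0) ∧
    (∀ δ : A →ₗ[F] A, IsDer b δ → ∃ x : A, ∀ y : A, δ y - b x y ∈ Leib b) := by
  have hsurj := (Leib b).mkQ_surjective
  have hz : ∀ x : A, (Leib b).mkQ x = 0 ↔ x ∈ Leib b := fun x => by simp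
  let _ : LieRing (A ⧸ Leib b) :=
    { bracket := fun u v => bq u v
      add_lie := fun x y z => by change bq _ _ = bq _ _ + bq _ _; simp
      lie_add := fun x y z => by change bq _ _ = bq _ _ + bq _ _; simp
      lie_self := fun u => by
        change bq u u = 0
        obtain ⟨x, rfl⟩ := hsurj u
        rw [hbq, hz]
        exact leib_self_mem b x
      leibniz_lie := fun u v w => by
        change bq u (bq v w) = bq (bq u v) w + bq v (bq u w)
        obtain ⟨x, rfl⟩ := hsurj u
        obtain ⟨y, rfl⟩ := hsurj v
        obtain ⟨z, rfl⟩ := hsurj w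
        simp only [hbq]
        rw [hb, map_add] }
  let _ : LieAlgebra F (A ⧸ Leib b) :=
    { lie_smul := fun t u v => by change bq _ _ = t • bq _ _; simp }
  have hbr : ∀ u v : A ⧸ Leib b, ⁅u, v⁆ = bq u v := fun _ _ => rfl
  obtain ⟨h1, h2⟩ := lie_complete (F := F) (A ⧸ Leib b) (by
    intro I hI
    let S : Submodule F A := I.toSubmodule.comap (Leib b).mkQ
    have hmS : ∀ x, x ∈ S ↔ (Leib b).mkQ x ∈ I := fun x => Iff.rfl
    have hS : S ≤ Leib b := by
      apply hss
      · intro x y hx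
        rw [hmS] at hx
        rw [hmS, hmS, ← hbq, ← hbq]
        exact ⟨lie_mem_left F _ I _ _ hx, lie_mem_right F _ I _ _ hx⟩
      · refine ⟨2, ?_⟩
        have hd1 : derSeries b S 1 ≤ Leib b := by
          refine Submodule.span_le.2 ?_
          rintro z ⟨x, hx, y, hy, rfl⟩
          change b x y ∈ Leib b
          rw [← hz, ← hbq]
          exact hI _ hx _ hy
        rw [eq_bot_iff]
        refine Submodule.span_le.2 ?_
        rintro z ⟨x, hx, y, hy, rfl⟩
        rw [leib_left_zero b hb (hd1 hx)]
        simp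
    rw [LieSubmodule.eq_bot_iff]
    intro u hu
    obtain ⟨x, rfl⟩ := hsurj u
    exact (hz x).2 (hS hu))
  refine ⟨h1, fun δ hδ => ?_⟩
  obtain ⟨u, hu⟩ := h2 ((Leib b).mapQ (Leib b) δ (leib_der b δ hδ)) (by
    intro u v
    obtain ⟨x, rfl⟩ := hsurj u
    obtain ⟨y, rfl⟩ := hsurj v
    have hm : ∀ x, (Leib b).mapQ (Leib b) δ (leib_der b δ hδ) ((Leib b).mkQ x)
      = (Leib b).mkQ (δ x) := fun x => rfl
    simp only [hbr, hbq, hm]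
    rw [hδ, map_add])
  obtain ⟨x, rfl⟩ := hsurj u
  refine ⟨x, fun y => ?_⟩
  have := hu ((Leib b).mkQ y)
  rw [hbr, hbq] at this
  rw [← hz, map_sub, sub_eq_zero]
  exact this
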